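/- arXiv:1209.6008 — 3 statements merged into one kernel-verified Lean document; each statement's English description precedes it below -/
import Mathlib

section
/- Let p be a prime, q a power of p, and F_q the finite field with q elements. For a sequence u : ℕ → F_q, the formal power series F = Σ_{n≥0} u_n t^n ∈ F_q[[t]] is algebraic over F_q(t) if and only if the sequence u is q-automatic. -/
/-- A sequence `u : ℕ → A` is `k`-automatic: there is a DFAO (finite state set `S`,
initial state `s₀`, transition function `δ`, output function `ω`) such that `u n` is
obtained by feeding the base-`k` digits of `n` (least significant first) to the automaton. -/
def IsKAutomatic (k : ℕ) {A : Type*} (u : ℕ → A) : Prop :=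
  ∃ (S : Type) (_ : Fintype S) (s₀ : S) (δ : S → ℕ → S) (ω : S → A),
    ∀ n : ℕ, u n = ω ((Nat.digits k n).foldl δ s₀)

namespace Christol

open PowerSeries

variable {F : Type*} [Field F] [Fintype F]

/-- The `r`-th section (Cartier) operator on power series. -/
noncomputable def lam (q r : ℕ) : F⟦X⟧ →+ F⟦X⟧ where
  toFun G := PowerSeries.mk fun n => coeff (q * n + r) G
  map_zero' := by ext; simp
  map_add' a b := by ext; simp

lemma coeff_lam (q r n : ℕ) (G : F⟦X⟧) : coeff n (lam q r G) = coeff (q * n + r) G := by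
  simp [lam]

/-- The `r`-th section operator on polynomials. -/
noncomputable def lamP (q r : ℕ) (P : Polynomial F) : Polynomial F :=
  trunc (P.natDegree + 1) (lam q r (P : F⟦X⟧))

lemma coeff_lamP {q : ℕ} (hq : 1 < q) (r n : ℕ) (P : Polynomial F) :
    (lamP q r P).coeff n = P.coeff (q * n + r) := by
  rw [lamP, coeff_trunc]
  split_ifs with h
  · simp [coeff_lam]
  · symm
    apply Polynomial.coeff_eq_zero_of_natDegree_lt
    nlinarith

lemma coe_lamP {q : ℕ} (hq : 1 < q) (r : ℕ) (P : Polynomial F) :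
    ((lamP q r P : Polynomial F) : F⟦X⟧) = lam q r (P : F⟦X⟧) := by
  ext n
  simp [coeff_lamP hq, coeff_lam]

lemma natDegree_lamP {q : ℕ} (hq : 1 < q) (r N : ℕ) (P : Polynomial F)
    (hP : P.natDegree ≤ 2 * N) : (lamP q r P).natDegree ≤ N := by
  rw [Polynomial.natDegree_le_iff_coeff_eq_zero]
  intro n hn
  rw [coeff_lamP hq]
  apply Polynomial.coeff_eq_zero_of_natDegree_lt
  nlinarith

lemma exists_lamP_ne_zero {q : ℕ} (hq : 1 < q) (P : Polynomial F) (hP : P ≠ 0) :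
    ∃ r < q, lamP q r P ≠ 0 := by
  refine ⟨P.natDegree % q, Nat.mod_lt _ (by omega), fun h => ?_⟩
  have := congrArg (fun Q => Polynomial.coeff Q (P.natDegree / q)) h
  simp only [coeff_lamP hq, Nat.div_add_mod] at this
  simp at this
  exact hP this

lemma pow_card_eq {q : ℕ} (hcard : Fintype.card F = q) (h0 : q ≠ 0) (G : F⟦X⟧) :
    G ^ q = expand q h0 G := by
  obtain ⟨p, n, hp, hc⟩ := FiniteField.card' F
  have : CharP F p := n
  have : Fact p.Prime := ⟨hc.1⟩
  have hqp : q = p ^ (hp : ℕ) := by rw [← hcard]; exact hc.2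
  subst hqp
  have h := MvPowerSeries.map_iterateFrobenius_expand (R := F) p hc.1.ne_zero G hp
  have hid : iterateFrobenius F p hp = RingHom.id F := by
    ext x
    rw [iterateFrobenius_def, ← hcard, FiniteField.pow_card]; rfl
  rw [hid, MvPowerSeries.map_id] at h
  exact h.symm

lemma lam_pow_mul {q : ℕ} (hcard : Fintype.card F = q) {r : ℕ} (hr : r < q) (G H : F⟦X⟧) :
    lam q r (G ^ q * H) = G * lam q r H := by
  have h0 : q ≠ 0 := by omega
  rw [pow_card_eq hcard h0]
  ext n
  rw [coeff_lam, coeff_mul, coeff_mul]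
  symm
  refine Finset.sum_of_injOn (fun x => (q * x.1, q * x.2 + r)) ?_ ?_ ?_ ?_
  · rintro ⟨a, b⟩ - ⟨c, d⟩ - h
    simpa [h0] using h
  · rintro ⟨a, b⟩ h
    simp at h ⊢
    subst h; ring
  · rintro ⟨a, b⟩ h h'
    simp at h h'
    rw [coeff_expand, if_neg, zero_mul]
    rintro ⟨c, rfl⟩
    have hc : c ≤ n := by
      by_contra hc
      have : q * (n + 1) ≤ q * c := Nat.mul_le_mul_left _ (by omega)
      rw [mul_add] at this
      omega
    obtain ⟨d, rfl⟩ := Nat.exists_eq_add_of_le hc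
    refine h' c d rfl rfl ?_
    rw [mul_add] at h
    omega
  · rintro ⟨a, b⟩ h
    simp [coeff_lam]

lemma ext_lam {q : ℕ} (h0 : 0 < q) {G H : F⟦X⟧} (h : ∀ r < q, lam q r G = lam q r H) : G = H := by
  ext n
  have := congrArg (coeff (n / q)) (h (n % q) (Nat.mod_lt _ h0))
  simpa [coeff_lam, Nat.div_add_mod] using this

lemma lam_X_pow {q r s : ℕ} (hr : r < q) (hs : s < q) :
    lam q s (X ^ r : F⟦X⟧) = if s = r then 1 else 0 := by
  ext n
  rw [coeff_lam, coeff_X_pow]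
  rcases Nat.eq_zero_or_pos n with rfl | hn
  · split_ifs <;> simp <;> omega
  · rw [if_neg]
    · split_ifs <;> simp [coeff_one, hn.ne']
    · nlinarith

lemma decomp {q : ℕ} (hcard : Fintype.card F = q) (h0 : 0 < q) (G : F⟦X⟧) :
    G = ∑ r ∈ Finset.range q, (X ^ r : F⟦X⟧) * (lam q r G) ^ q := by
  apply ext_lam h0
  intro s hs
  rw [map_sum, Finset.sum_eq_single_of_mem s (by simpa using hs)]
  · rw [mul_comm, lam_pow_mul hcard hs, lam_X_pow hs hs]; simp
  · intro r hr hrs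
    rw [mul_comm, lam_pow_mul hcard hs, lam_X_pow (by simpa using hr) hs, if_neg hrs.symm, mul_zero]

lemma pow_card_sum {q : ℕ} (hcard : Fintype.card F = q) (h0 : q ≠ 0) {ι : Type*} (s : Finset ι)
    (f : ι → F⟦X⟧) : (∑ i ∈ s, f i) ^ q = ∑ i ∈ s, f i ^ q := by
  simp only [pow_card_eq hcard h0, map_sum]

lemma isAlgebraic_of_span {q : ℕ} (hcard : Fintype.card F = q) (hq : 1 < q)
    {ι : Type*} [Fintype ι] (G : ι → F⟦X⟧)
    (h : ∀ i, G i ∈ Submodule.span (Polynomial F) (Set.range fun j => G j ^ q)) (i₀ : ι) :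
    IsAlgebraic (Polynomial F) (G i₀) := by
  have h0 : q ≠ 0 := by omega
  have hA : ∀ k i, G i ^ q ^ k ∈
      Submodule.span (Polynomial F) (Set.range fun j => G j ^ q ^ (k + 1)) := by
    intro k
    induction k with
    | zero => simpa using h
    | succ k ih =>
      intro i
      obtain ⟨c, hc⟩ := (Submodule.mem_span_range_iff_exists_fun _).1 (ih i)
      refine (Submodule.mem_span_range_iff_exists_fun _).2 ⟨fun j => c j ^ q, ?_⟩
      rw [pow_succ q k, pow_mul, ← hc, pow_card_sum hcard h0]
      refine Finset.sum_congr rfl fun j _ => ?_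
      rw [smul_pow, ← pow_mul, ← pow_succ]
  have hB : ∀ k m i, G i ^ q ^ k ∈
      Submodule.span (Polynomial F) (Set.range fun j => G j ^ q ^ (k + m)) := by
    intro k m
    induction m with
    | zero => intro i; exact Submodule.subset_span ⟨i, rfl⟩
    | succ m ih =>
      intro i
      refine (Submodule.span_le.2 ?_) (ih i)
      rintro _ ⟨j, rfl⟩
      exact hA (k + m) j
  set d := Fintype.card ι with hd
  have hC : ∀ k : Fin (d + 1), ∃ c : ι → Polynomial F,
      ∑ j, c j • G j ^ q ^ d = G i₀ ^ q ^ (k : ℕ) := by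
    intro k
    have := hB k (d - k) i₀
    rw [Nat.add_sub_cancel' (by omega)] at this
    exact (Submodule.mem_span_range_iff_exists_fun _).1 this
  choose c hc using hC
  have hli : ¬ LinearIndependent (Polynomial F) c := by
    intro hli
    have := hli.fintype_card_le_finrank
    simp [← hd] at this
  obtain ⟨g, hg, k₀, hk₀⟩ := Fintype.not_linearIndependent_iff.1 hli
  refine ⟨∑ k : Fin (d + 1), Polynomial.monomial (q ^ (k : ℕ)) (g k), fun hz => hk₀ ?_, ?_⟩
  · have := congrArg (fun Q => Polynomial.coeff Q (q ^ (k₀ : ℕ))) hz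
    simp only [Polynomial.finsetSum_coeff, Polynomial.coeff_monomial, Polynomial.coeff_zero] at this
    rw [Finset.sum_eq_single_of_mem k₀ (Finset.mem_univ _)] at this
    · simpa using this
    · intro k _ hk
      rw [if_neg]
      intro he
      exact hk (Fin.ext (Nat.pow_right_injective hq he))
  · rw [map_sum]
    simp only [Polynomial.aeval_monomial, ← Algebra.smul_def, ← hc, Finset.smul_sum]
    rw [Finset.sum_comm]
    refine Finset.sum_eq_zero fun j _ => ?_
    have := congrFun hg j
    simp only [Finset.sum_apply, Pi.smul_apply, smul_eq_mul, Pi.zero_apply] at this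
    simp only [smul_smul, ← Finset.sum_smul, this, zero_smul]

lemma isAlgebraic_of_automatic {q : ℕ} (hcard : Fintype.card F = q) (hq : 1 < q) (u : ℕ → F)
    (h : IsKAutomatic q u) : IsAlgebraic (Polynomial F) (PowerSeries.mk u) := by
  obtain ⟨S, _, s₀, δ, ω, hu⟩ := h
  let f : S → F⟦X⟧ := fun s => PowerSeries.mk fun n => ω ((Nat.digits q n).foldl δ s)
  have hf0 : PowerSeries.mk u = f s₀ := by
    ext n; simp [f, hu]
  have hlam : ∀ s, ∀ r < q, lam q r (f s) =
      f (δ s r) + if r = 0 then C (ω s - ω (δ s 0)) else 0 := by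
    intro s r hr
    ext n
    rw [coeff_lam, map_add]
    simp only [f, coeff_mk]
    by_cases hn : n = 0 ∧ r = 0
    · obtain ⟨rfl, rfl⟩ := hn
      simp
    · have hdig : Nat.digits q (q * n + r) = r :: Nat.digits q n := by
        rw [add_comm]
        exact Nat.digits_add q hq r n hr (by omega)
      rw [hdig, List.foldl_cons]
      split_ifs with h
      · rw [coeff_C, if_neg (by omega), add_zero]
      · simp
  rw [hf0]
  let G : Option S → F⟦X⟧ := fun o => o.elim 1 f
  refine isAlgebraic_of_span hcard hq G ?_ (some s₀)
  have hone : (1 : F⟦X⟧) ∈ Submodule.span (Polynomial F) (Set.range fun j => G j ^ q) :=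
    Submodule.subset_span ⟨none, by simp [G]⟩
  have hmem : ∀ s, f s ^ q ∈ Submodule.span (Polynomial F) (Set.range fun j => G j ^ q) :=
    fun s => Submodule.subset_span ⟨some s, by simp [G]⟩
  have hsm : ∀ (P : Polynomial F) (H : F⟦X⟧), (P : F⟦X⟧) * H = P • H := fun P H => by
    rw [Algebra.smul_def]; rfl
  rintro (_ | s)
  · exact hone
  · show f s ∈ _
    rw [decomp hcard (by omega) (f s)]
    refine Submodule.sum_mem _ fun r hr => ?_
    rw [← Polynomial.coe_X, ← Polynomial.coe_pow, hsm]
    refine Submodule.smul_mem _ _ ?_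
    rw [hlam s r (by simpa using hr), pow_card_eq hcard (by omega), map_add,
      ← pow_card_eq hcard (by omega)]
    refine Submodule.add_mem _ (hmem _) ?_
    split_ifs
    · rw [expand_C, ← Polynomial.coe_C, ← mul_one ((Polynomial.C _ : Polynomial F) : F⟦X⟧), hsm]
      exact Submodule.smul_mem _ _ hone
    · simp

lemma exists_relation {q : ℕ} (hq : 1 < q) (f : F⟦X⟧)
    (h : IsAlgebraic (Polynomial F) f) :
    ∃ (N : ℕ) (a : ℕ → Polynomial F), (∃ j < N, a j ≠ 0) ∧
      ∑ i ∈ Finset.range N, (a i : F⟦X⟧) * f ^ q ^ i = 0 := by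
  obtain ⟨y, hy, hint⟩ := h.exists_integral_multiple
  have := Algebra.finite_adjoin_simple_of_isIntegral hint
  let v : ℕ → Algebra.adjoin (Polynomial F) {y • f} :=
    fun i => ⟨y • f, Algebra.subset_adjoin rfl⟩ ^ q ^ i
  have hv : ¬ LinearIndependent (Polynomial F) v := by
    intro hli
    have := hli.finite_of_isNoetherian
    exact not_finite ℕ
  obtain ⟨s, g, hs, j, hj, hgj⟩ := not_linearIndependent_iff.1 hv
  refine ⟨s.sup id + 1, fun i => if i ∈ s then g i * y ^ q ^ i else 0, ⟨j, ?_, ?_⟩, ?_⟩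
  · exact Nat.lt_succ_of_le (Finset.le_sup (f := id) hj)
  · simp [hj, hgj, hy]
  · have h2 := congrArg (Subtype.val) hs
    rw [← Finset.sum_subset (s₁ := s)]
    · have h3 : ∑ i ∈ s, (g i * y ^ q ^ i) • f ^ q ^ i = 0 := by
        simpa [v, smul_pow, smul_smul] using h2
      rw [← h3]
      refine Finset.sum_congr rfl fun i hi => ?_
      simp only [if_pos hi, Algebra.smul_def]; rfl
    · intro i hi
      exact Finset.mem_range.2 (Nat.lt_succ_of_le (Finset.le_sup (f := id) hi))
    · intro i _ hi
      simp [hi]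

lemma descend {q : ℕ} (hcard : Fintype.card F = q) (hq : 1 < q) (f : F⟦X⟧) :
    ∀ (j N : ℕ) (a : ℕ → Polynomial F), j < N → a j ≠ 0 →
      ∑ i ∈ Finset.range N, (a i : F⟦X⟧) * f ^ q ^ i = 0 →
    ∃ (N : ℕ) (a : ℕ → Polynomial F), a 0 ≠ 0 ∧
      ∑ i ∈ Finset.range (N + 1), (a i : F⟦X⟧) * f ^ q ^ i = 0 := by
  intro j
  induction j with
  | zero =>
    intro N a hN ha h
    obtain ⟨M, rfl⟩ : ∃ M, N = M + 1 := ⟨N - 1, by omega⟩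
    exact ⟨M, a, ha, h⟩
  | succ j ih =>
    intro N a hN ha h
    obtain ⟨M, rfl⟩ : ∃ M, N = M + 1 := ⟨N - 1, by omega⟩
    by_cases ha0 : a 0 = 0
    · obtain ⟨r, hr, hne⟩ := exists_lamP_ne_zero hq _ ha
      refine ih M (fun i => lamP q r (a (i + 1))) (by omega) hne ?_
      rw [Finset.sum_range_succ', ha0, Polynomial.coe_zero, zero_mul, add_zero] at h
      have h2 := congrArg (lam q r) h
      rw [map_sum, map_zero] at h2
      rw [← h2]
      refine Finset.sum_congr rfl fun i _ => ?_
      rw [coe_lamP hq, pow_succ q i, pow_mul, mul_comm _ ((f ^ q ^ i) ^ q), lam_pow_mul hcard hr,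
        mul_comm]
    · exact ⟨M, a, ha0, h⟩

lemma automatic_of_finite_set {q : ℕ} (hq : 1 < q) (u : ℕ → F) (W : Set F⟦X⟧) (hW : W.Finite)
    (hu : PowerSeries.mk u ∈ W) (hst : ∀ r < q, ∀ G ∈ W, lam q r G ∈ W) : IsKAutomatic q u := by
  have : Finite W := hW
  obtain ⟨n, ⟨e⟩⟩ := Finite.exists_equiv_fin W
  let δ' : W → ℕ → W := fun G r => ⟨lam q (r % q) G, hst _ (Nat.mod_lt _ (by omega)) _ G.2⟩
  refine ⟨Fin n, inferInstance, e ⟨_, hu⟩, fun s r => e (δ' (e.symm s) r),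
    fun s => constantCoeff (e.symm s : F⟦X⟧), ?_⟩
  have key : ∀ n (G : W), coeff n (G : F⟦X⟧) = constantCoeff (e.symm ((Nat.digits q n).foldl
      (fun s r => e (δ' (e.symm s) r)) (e G)) : F⟦X⟧) := by
    intro n
    induction n using Nat.strong_induction_on with
    | _ n ih =>
      intro G
      rcases Nat.eq_zero_or_pos n with rfl | hn
      · simp
      · rw [Nat.digits_def' hq hn, List.foldl_cons, Equiv.symm_apply_apply,
          ← ih (n / q) (Nat.div_lt_self hn hq)]
        simp [δ', coeff_lam, Nat.div_add_mod]
  intro n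
  refine Eq.trans ?_ (key n ⟨_, hu⟩)
  simp

lemma finite_combos (k D : ℕ) (P : ℕ → F⟦X⟧) :
    {H : F⟦X⟧ | ∃ c : ℕ → Polynomial F, (∀ i, (c i).natDegree ≤ D) ∧
      H = ∑ i ∈ Finset.range k, (c i : F⟦X⟧) * P i}.Finite := by
  have : Finite (Polynomial.degreeLT F (D + 1)) :=
    Finite.of_equiv _ (Polynomial.degreeLTEquiv F (D + 1)).symm.toEquiv
  refine (Set.finite_range (fun c : Fin k → Polynomial.degreeLT F (D + 1) =>
    ∑ i, ((c i : Polynomial F) : F⟦X⟧) * P i)).subset ?_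
  rintro _ ⟨c, hc, rfl⟩
  refine ⟨fun i => ⟨c i, ?_⟩, ?_⟩
  · rw [Polynomial.mem_degreeLT]
    exact lt_of_le_of_lt Polynomial.degree_le_natDegree (by
      exact_mod_cast Nat.lt_succ_of_le (hc i))
  · simp only
    rw [Finset.sum_range]

lemma automatic_of_isAlgebraic {q : ℕ} (hcard : Fintype.card F = q) (hq : 1 < q) (u : ℕ → F)
    (h : IsAlgebraic (Polynomial F) (PowerSeries.mk u)) : IsKAutomatic q u := by
  set f : F⟦X⟧ := PowerSeries.mk u with hf
  obtain ⟨N, a₁, ⟨j, hj, haj⟩, h1⟩ := exists_relation hq f h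
  obtain ⟨m, a₂, ha₂, h2⟩ := descend hcard hq f j N a₁ hj haj h1
  obtain ⟨a, ha, hrel⟩ : ∃ a : ℕ → Polynomial F, a 0 ≠ 0 ∧
      ∑ i ∈ Finset.range (m + 2), (a i : F⟦X⟧) * f ^ q ^ i = 0 := by
    refine ⟨fun i => if i < m + 1 then a₂ i else 0, by simpa using ha₂, ?_⟩
    rw [Finset.sum_range_succ, ← h2]
    simp only [lt_irrefl, if_false, Polynomial.coe_zero, zero_mul, add_zero]
    refine Finset.sum_congr rfl fun i hi => ?_
    rw [if_pos (Finset.mem_range.1 hi)]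
  set α : F⟦X⟧ := (a 0 : F⟦X⟧) with hα
  have hα0 : α ≠ 0 := by simpa [hα] using ha
  have hq0 : q ≠ 0 := by omega
  set Q := q ^ (m + 1) with hQ
  have hαf : α * f = - ∑ i ∈ Finset.range (m + 1), (a (i + 1) : F⟦X⟧) * f ^ q ^ (i + 1) := by
    rw [Finset.sum_range_succ'] at hrel
    rw [pow_zero, pow_one] at hrel
    exact eq_neg_of_add_eq_zero_right hrel
  let b : ℕ → Polynomial F := fun i => a (i + 1) * a 0 ^ (q ^ (i + 1) - 2)
  let D := (a 0).natDegree + ∑ i ∈ Finset.range (m + 1), (b i).natDegree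
  have hbD : ∀ i < m + 1, (b i).natDegree ≤ D := fun i hi =>
    (Finset.single_le_sum (f := fun i => (b i).natDegree) (fun _ _ => Nat.zero_le _)
      (Finset.mem_range.2 hi)).trans (Nat.le_add_left _ _)
  have hqm : ∀ i, 2 ≤ q ^ (i + 1) := fun i => by
    have := Nat.pow_le_pow_right (n := q) (by omega) (show 1 ≤ i + 1 by omega)
    rw [pow_one] at this
    omega
  have hmono : ∀ {i j : ℕ}, i ≤ j → q ^ i ≤ q ^ j := fun h =>
    Nat.pow_le_pow_right (by omega) h
  let W : Set F⟦X⟧ := (fun H => α ^ Q * H) ⁻¹'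
    {H : F⟦X⟧ | ∃ c : ℕ → Polynomial F, (∀ i, (c i).natDegree ≤ D) ∧
      H = ∑ i ∈ Finset.range (m + 2), (c i : F⟦X⟧) * (α ^ (Q - q ^ i) * f ^ q ^ i)}
  refine automatic_of_finite_set hq u W ?_ ?_ ?_
  · refine Set.Finite.preimage ?_ (finite_combos _ _ _)
    exact (mul_right_injective₀ (pow_ne_zero _ hα0)).injOn
  · refine ⟨fun i => if i = 0 then a 0 else 0, fun i => ?_, ?_⟩
    · dsimp only
      split_ifs
      · exact Nat.le_add_right _ _
      · simp
    · rw [Finset.sum_eq_single_of_mem 0 (by simp)]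
      · simp only [if_true, pow_zero, pow_one]
        rw [← hα, ← hf, ← mul_assoc, ← pow_succ', Nat.sub_add_cancel]
        exact Nat.one_le_pow _ _ (by omega)
      · intro i _ hi
        simp [hi]
  · rintro r hr H ⟨c, hc, hH⟩
    change α ^ Q * H = _ at hH
    let e : ℕ → Polynomial F := fun i => c (i + 1) - c 0 * b i
    have hbdeg : ∀ i < m + 1, (e i).natDegree ≤ 2 * D := by
      intro i hi
      refine (Polynomial.natDegree_sub_le _ _).trans (max_le ((hc _).trans (by omega)) ?_)
      refine Polynomial.natDegree_mul_le.trans ?_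
      have := hc 0
      have := hbD i hi
      omega
    have h3 : α ^ Q * H = ∑ i ∈ Finset.range (m + 1),
        (α ^ (q ^ m - q ^ i) * f ^ q ^ i) ^ q * (e i : F⟦X⟧) := by
      rw [hH, Finset.sum_range_succ']
      have h4 : (c 0 : F⟦X⟧) * (α ^ (Q - q ^ 0) * f ^ q ^ 0) =
          (c 0 : F⟦X⟧) * α ^ (Q - 2) * (α * f) := by
        have : Q - q ^ 0 = (Q - 2) + 1 := by
          have := hqm m
          rw [pow_zero]; omega
        rw [this, pow_zero]; ring
      rw [h4, hαf, mul_neg, ← sub_eq_add_neg, Finset.mul_sum, ← Finset.sum_sub_distrib]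
      refine Finset.sum_congr rfl fun i hi => ?_
      have hi' := Finset.mem_range.1 hi
      have h5 : α ^ (Q - 2) = α ^ (q ^ (i + 1) - 2) * α ^ (Q - q ^ (i + 1)) := by
        rw [← pow_add]
        congr 1
        have := hqm i
        have := hmono (show i + 1 ≤ m + 1 by omega)
        omega
      have h6 : (α ^ (q ^ m - q ^ i) * f ^ q ^ i) ^ q =
          α ^ (Q - q ^ (i + 1)) * f ^ q ^ (i + 1) := by
        rw [mul_pow, ← pow_mul, ← pow_mul, ← pow_succ, Nat.sub_mul, ← pow_succ, ← pow_succ]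
      rw [h5, h6]
      simp only [e, b, Polynomial.coe_sub, Polynomial.coe_mul, Polynomial.coe_pow, ← hα]
      ring
    have h7 := congrArg (lam q r) h3
    rw [hQ, pow_succ q m, pow_mul, lam_pow_mul hcard hr, map_sum] at h7
    refine ⟨fun i => if i < m + 1 then lamP q r (e i) else 0, fun i => ?_, ?_⟩
    · dsimp only
      split_ifs with hi
      · exact natDegree_lamP hq _ _ _ (hbdeg i hi)
      · simp
    · change α ^ Q * lam q r H = _
      have h8 : α ^ Q = α ^ (Q - q ^ m) * α ^ q ^ m := by
        rw [← pow_add, Nat.sub_add_cancel (hmono (by omega))]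
      rw [h8, mul_assoc, h7, Finset.sum_range_succ _ (m + 1)]
      simp only [lt_irrefl, if_false, Polynomial.coe_zero, zero_mul, add_zero]
      rw [Finset.mul_sum]
      refine Finset.sum_congr rfl fun i hi => ?_
      have hi' := Finset.mem_range.1 hi
      rw [if_pos hi', lam_pow_mul hcard hr, coe_lamP hq]
      have h9 : α ^ (Q - q ^ i) = α ^ (Q - q ^ m) * α ^ (q ^ m - q ^ i) := by
        rw [← pow_add]
        congr 1
        have := hmono (show i ≤ m by omega)
        have := hmono (show m ≤ m + 1 by omega)
        omega
      rw [h9]; ring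

end Christol

/-- Christol's theorem: for `q = pⁿ` a prime power and `F_q` the field with `q` elements,
the power series `∑ uₙ tⁿ` is algebraic over `F_q(t)` (equivalently, over the subring
`F_q[t]` of `F_q[[t]]`) if and only if the sequence `u` is `q`-automatic. -/
theorem christol
    (p q : ℕ) (hp : p.Prime) (hq : ∃ n : ℕ, 1 ≤ n ∧ q = p ^ n)
    (Fq : Type*) [Field Fq] [Fintype Fq] (hcard : Fintype.card Fq = q)
    (u : ℕ → Fq) :
    IsAlgebraic (Polynomial Fq) (PowerSeries.mk u) ↔ IsKAutomatic q u := by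
  have hq1 : 1 < q := hcard ▸ Fintype.one_lt_card
  exact ⟨Christol.automatic_of_isAlgebraic hcard hq1 u,
    Christol.isAlgebraic_of_automatic hcard hq1 u⟩
end

section
/- Let k ≥ 2 be an integer and A a finite set. A sequence u : ℕ → A is k-automatic if and only if its k-kernel, the set of sequences { n ↦ u(k^j·n + r) : j ≥ 0, 0 ≤ r ≤ k^j − 1 }, is finite. -/
/-- Eilenberg's theorem: a sequence `u` over a finite alphabet is `k`-automatic if and only if
its `k`-kernel `{ n ↦ u(kʲ·n + r) : j ≥ 0, 0 ≤ r ≤ kʲ - 1 }` is finite. -/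
theorem automatic_iff_kernel_finite
    (k : ℕ) (hk : 2 ≤ k) (A : Type*) [Fintype A] (u : ℕ → A) :
    IsKAutomatic k u ↔
      {v : ℕ → A | ∃ (j r : ℕ), r < k ^ j ∧ v = fun n => u (k ^ j * n + r)}.Finite := by
  constructor
  · rintro ⟨S, _, s₀, δ, ω, h⟩
    have key : ∀ j r : ℕ, r < k ^ j → ∀ s : S, ∃ t : S, ∀ n, n ≠ 0 →
        (Nat.digits k (k ^ j * n + r)).foldl δ s = (Nat.digits k n).foldl δ t := by
      intro j
      induction j with
      | zero =>
        intro r hr s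
        refine ⟨s, fun n _ => ?_⟩
        have : r = 0 := by simpa using hr
        simp [this]
      | succ j ih =>
        intro r hr s
        have hr' : r / k < k ^ j := by
          apply Nat.div_lt_of_lt_mul
          rwa [pow_succ, mul_comm] at hr
        obtain ⟨t, ht⟩ := ih (r / k) hr' (δ s (r % k))
        refine ⟨t, fun n hn => ?_⟩
        rw [← ht n hn]
        have hpos : 0 < k ^ (j + 1) * n + r := by
          have : 0 < k ^ (j + 1) * n := by positivity
          omega
        have e : k ^ (j + 1) * n + r = r + k * (k ^ j * n) := by ring
        rw [Nat.digits_def' (by omega) hpos, e, Nat.add_mul_mod_self_left,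
          Nat.add_mul_div_left _ _ (by omega), List.foldl_cons, add_comm (r / k)]
    refine (Set.finite_range (fun p : S × A => fun n : ℕ =>
      if n = 0 then p.2 else ω ((Nat.digits k n).foldl δ p.1))).subset ?_
    rintro v ⟨j, r, hr, rfl⟩
    obtain ⟨t, ht⟩ := key j r hr s₀
    refine ⟨(t, u r), ?_⟩
    funext n
    by_cases hn : n = 0
    · simp [hn]
    · simp only [hn, if_false]
      rw [h, ht n hn]
  · intro hfin
    set K := {v : ℕ → A | ∃ (j r : ℕ), r < k ^ j ∧ v = fun n => u (k ^ j * n + r)} with hK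
    have hu : u ∈ K := ⟨0, 0, by simp, by simp⟩
    have hcl : ∀ v ∈ K, ∀ d, d < k → (fun n => v (k * n + d)) ∈ K := by
      rintro v ⟨j, r, hr, rfl⟩ d hd
      refine ⟨j + 1, k ^ j * d + r, ?_, ?_⟩
      · calc k ^ j * d + r < k ^ j * d + k ^ j := by omega
          _ = k ^ j * (d + 1) := by ring
          _ ≤ k ^ j * k := Nat.mul_le_mul_left _ hd
          _ = k ^ (j + 1) := by ring
      · funext n
        have e : k ^ j * (k * n + d) + r = k ^ (j + 1) * n + (k ^ j * d + r) := by ring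
        simp only [e]
    have : Finite K := hfin
    obtain ⟨m, ⟨e⟩⟩ := Finite.exists_equiv_fin K
    let δ' : K → ℕ → K := fun v d =>
      ⟨fun n => v.1 (k * n + d % k), hcl v.1 v.2 _ (Nat.mod_lt _ (by omega))⟩
    refine ⟨Fin m, inferInstance, e ⟨u, hu⟩, fun s d => e (δ' (e.symm s) d),
      fun s => (e.symm s).1 0, ?_⟩
    have main : ∀ n : ℕ, ∀ v : K, v.1 n =
        (e.symm ((Nat.digits k n).foldl (fun s d => e (δ' (e.symm s) d)) (e v))).1 0 := by
      intro n
      induction n using Nat.strong_induction_on with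
      | _ n ih =>
        intro v
        rcases Nat.eq_zero_or_pos n with rfl | hn
        · simp
        · rw [Nat.digits_def' (by omega) hn, List.foldl_cons, Equiv.symm_apply_apply,
            ← ih (n / k) (Nat.div_lt_self hn (by omega))]
          simp only [δ', Nat.mod_mod, Nat.div_add_mod]
    exact fun n => main n ⟨u, hu⟩
end

section
/- Let k ≥ 2 be an integer and A a finite set. A sequence u : ℕ → A is k-automatic if and only if there exist a finite set S, a substitution τ : S → S^k of constant length k, a sequence v : ℕ → S with v(k·n + j) = τ(v(n))(j) for all n ≥ 0 and 0 ≤ j ≤ k−1 (i.e. v is a fixed point of τ), and a map π : S → A (a letter-to-letter projection) such that u = π ∘ v. -/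
/-- Cobham's theorem: a sequence `u` over a finite alphabet is `k`-automatic if and only if it
is the image, under a letter-to-letter projection `π`, of a fixed point `v` of a substitution
`τ` of constant length `k`. -/
theorem automatic_iff_projection_of_substitution_fixed_point
    (k : ℕ) (hk : 2 ≤ k) (A : Type*) [Fintype A] (u : ℕ → A) :
    IsKAutomatic k u ↔
      ∃ (S : Type) (_ : Fintype S) (τ : S → Fin k → S) (v : ℕ → S) (π : S → A),
        (∀ (n : ℕ) (j : Fin k), v (k * n + (j : ℕ)) = τ (v n) j) ∧
        u = π ∘ v := by
  classical
  have hdig : ∀ n j : ℕ, j < k → k * n + j ≠ 0 →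
      Nat.digits k (k * n + j) = j :: Nat.digits k n := by
    intro n j hj h0
    rw [add_comm]
    refine Nat.digits_add k (by omega) j n hj ?_
    by_contra hcon
    push Not at hcon
    obtain ⟨rfl, rfl⟩ := hcon
    simp at h0
  constructor
  · rintro ⟨S, hS, s₀, δ, ω, hu⟩
    refine ⟨Option (S → S), inferInstance,
      fun o j => match o with
        | none => if (j : ℕ) = 0 then none else some (fun s => δ s j)
        | some f => some (fun s => f (δ s j)),
      fun n => if n = 0 then none else some (fun s => (Nat.digits k n).foldl δ s),
      fun o => match o with
        | none => ω s₀
        | some f => ω (f s₀), ?_, ?_⟩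
    · intro n j
      by_cases hn : n = 0
      · subst hn
        by_cases hj : (j : ℕ) = 0
        · simp [hj]
        · have := hdig 0 j j.2 (by omega)
          simp only [mul_zero, zero_add] at this
          simp [hj, this]
      · have h0 : k * n + (j : ℕ) ≠ 0 := by
          have : 0 < k * n := Nat.mul_pos (by omega) (by omega)
          omega
        simp only [if_neg hn, if_neg h0, hdig n j j.2 h0, List.foldl_cons]
    · funext n
      rw [hu n]
      by_cases hn : n = 0
      · simp [hn]
      · simp [hn]
  · rintro ⟨S, hS, τ, v, π, hv, rfl⟩
    refine ⟨S → S, inferInstance, id,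
      fun g d s => g (if h : d < k then τ s ⟨d, h⟩ else s), fun g => π (g (v 0)), ?_⟩
    have key : ∀ n : ℕ, ∀ g : S → S,
        (Nat.digits k n).foldl
          (fun (g : S → S) d s => g (if h : d < k then τ s ⟨d, h⟩ else s)) g (v 0)
          = g (v n) := by
      intro n
      induction n using Nat.strong_induction_on with
      | _ n ih =>
        intro g
        by_cases hn : n = 0
        · simp [hn]
        · have hd : n % k < k := Nat.mod_lt _ (by omega)
          have e : k * (n / k) + n % k = n := Nat.div_add_mod n k
          have h1 := hdig (n / k) (n % k) hd (by omega)
          rw [e] at h1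
          have h2 := hv (n / k) ⟨n % k, hd⟩
          simp only [e] at h2
          rw [h1, List.foldl_cons, ih (n / k) (Nat.div_lt_self (by omega) (by omega)), h2]
          simp [hd]
    intro n
    exact (congrArg π (key n id)).symm
end
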